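/- arXiv:2204.12804 — 6 statements merged into one kernel-verified Lean document; each statement's English description precedes it below -/
import Mathlib

section
/- Let d ≥ 1 and β : {1,…,d} → ℝ with β_i ≥ 0, Σ_i β_i² = 1, β_1 = max_i β_i and β_1 > 0. Set ψ = Σ_i β_i |i⟩, W = β_1² I − |ψ⟩⟨ψ|, and for each sign vector a let 𝒲_a = I/d − |φ_a⟩⟨φ_a|. Let γ_i = β_i/β_1 for i = 2,…,d and let p be the probability distribution on sign vectors given by p(a) = ∏_{i=2}^d (1 + a_i γ_i)/2. Then the operator D = W − d β_1² Σ_a p(a) 𝒲_a is a diagonal matrix whose i-th diagonal entry equals β_1² − β_i² ≥ 0; in particular D is positive semidefinite. -/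
open Matrix ComplexOrder

lemma units_sum_aux (f : ℤˣ → ℝ) : ∑ s : ℤˣ, f s = f 1 + f (-1) := by
  have : (Finset.univ : Finset ℤˣ) = {1, -1} := by decide
  rw [this, Finset.sum_pair (by decide)]

lemma moment_aux {d : ℕ} (g : Fin d → ℝ) (i₁ i j : Fin d) (hg : g i₁ = 1) (hij : i ≠ j) :
    ∑ a ∈ Finset.univ.filter (fun a : Fin d → ℤˣ => a i₁ = 1),
      (∏ k ∈ Finset.univ.erase i₁, (1 + ((a k : ℤ) : ℝ) * g k) / 2) *
        (((a i : ℤ) : ℝ) * ((a j : ℤ) : ℝ)) = g i * g j := by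
  have h1 : ∀ a : Fin d → ℤˣ,
      (if a i₁ = 1 then (∏ k ∈ Finset.univ.erase i₁, (1 + ((a k : ℤ) : ℝ) * g k) / 2) *
        (((a i : ℤ) : ℝ) * ((a j : ℤ) : ℝ)) else 0) =
      ∏ k, ((1 + ((a k : ℤ) : ℝ) * g k) / 2 *
        ((if k = i then ((a k : ℤ) : ℝ) else 1) * (if k = j then ((a k : ℤ) : ℝ) else 1))) := by
    intro a
    rw [Finset.prod_mul_distrib, Finset.prod_mul_distrib,
      Finset.prod_ite_eq' , Finset.prod_ite_eq',
      ← Finset.mul_prod_erase Finset.univ _ (Finset.mem_univ i₁), hg]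
    rcases Int.units_eq_one_or (a i₁) with h | h <;> simp [h]
  rw [Finset.sum_filter, Finset.sum_congr rfl (fun a _ => h1 a)]
  have h2 := Finset.prod_univ_sum (fun _ : Fin d => (Finset.univ : Finset ℤˣ))
    (fun k s => (1 + ((s : ℤ) : ℝ) * g k) / 2 *
        ((if k = i then ((s : ℤ) : ℝ) else 1) * (if k = j then ((s : ℤ) : ℝ) else 1)))
  rw [Fintype.piFinset_univ] at h2
  rw [← h2]
  have h3 : ∀ k, ∑ s : ℤˣ, (1 + ((s : ℤ) : ℝ) * g k) / 2 *
        ((if k = i then ((s : ℤ) : ℝ) else 1) * (if k = j then ((s : ℤ) : ℝ) else 1)) =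
        (if k = i then g k else 1) * (if k = j then g k else 1) := by
    intro k
    rw [units_sum_aux]
    by_cases hi : k = i
    · have hj : k ≠ j := fun h => hij (hi.symm.trans h)
      simp only [hi, if_true, if_neg hij]
      push_cast
      ring
    · by_cases hj : k = j
      · simp only [hj, if_true, if_neg hij.symm]
        push_cast
        ring
      · simp only [hi, hj, if_false]
        push_cast
        ring
  rw [Finset.prod_congr rfl (fun k _ => h3 k), Finset.prod_mul_distrib,
    Finset.prod_ite_eq', Finset.prod_ite_eq']
  simp

/-- With β decreasingly bounded by β_1 > 0, ψ = Σ β_i|i⟩,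
W = β_1² I − |ψ⟩⟨ψ|, 𝒲_a = I/d − |φ_a⟩⟨φ_a| the RFCWs, γ_i = β_i/β_1 and
p(a) = ∏_{i=2}^d (1 + a_i γ_i)/2, the operator D = W − d β_1² Σ_a p(a) 𝒲_a is a
diagonal matrix with i-th diagonal entry β_1² − β_i² ≥ 0; in particular D is PSD. -/
theorem stmt_3 (d : ℕ) (hd : 0 < d) (β : Fin d → ℝ)
    (hβpos : ∀ i, 0 ≤ β i) (hβnorm : ∑ i, (β i) ^ 2 = 1)
    (hβmax : ∀ i, β i ≤ β ⟨0, hd⟩) (hβ1 : 0 < β ⟨0, hd⟩) :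
    let i₁ : Fin d := ⟨0, hd⟩
    let ψ : Fin d → ℂ := fun i => ((β i : ℝ) : ℂ)
    let W : Matrix (Fin d) (Fin d) ℂ :=
      ((β i₁ : ℂ) ^ 2) • (1 : Matrix (Fin d) (Fin d) ℂ) - Matrix.vecMulVec ψ (star ψ)
    let φ : (Fin d → ℤˣ) → Fin d → ℂ := fun a i => ((((a i : ℤ) : ℝ) / Real.sqrt d : ℝ) : ℂ)
    let 𝒲 : (Fin d → ℤˣ) → Matrix (Fin d) (Fin d) ℂ := fun a =>
      ((d : ℂ))⁻¹ • (1 : Matrix (Fin d) (Fin d) ℂ) - Matrix.vecMulVec (φ a) (star (φ a))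
    let p : (Fin d → ℤˣ) → ℝ := fun a =>
      ∏ i ∈ Finset.univ.erase i₁, (1 + ((a i : ℤ) : ℝ) * (β i / β i₁)) / 2
    let D : Matrix (Fin d) (Fin d) ℂ :=
      W - ((d : ℂ) * (β i₁ : ℂ) ^ 2) •
        ∑ a ∈ Finset.univ.filter (fun a : Fin d → ℤˣ => a i₁ = 1), ((p a : ℝ) : ℂ) • 𝒲 a
    D.IsDiag ∧ (∀ i, D i i = (((β i₁) ^ 2 - (β i) ^ 2 : ℝ) : ℂ)) ∧
    (∀ i, 0 ≤ (β i₁) ^ 2 - (β i) ^ 2) ∧ D.PosSemidef := by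
  intro i₁ ψ W φ 𝒲 p D
  have hd0 : (d : ℂ) ≠ 0 := by exact_mod_cast hd.ne'
  have hb : (β i₁ : ℂ) ≠ 0 := by exact_mod_cast hβ1.ne'
  have hφ : ∀ a i j, φ a i * star (φ a j) =
      (d : ℂ)⁻¹ * ((((a i : ℤ) : ℝ) * ((a j : ℤ) : ℝ) : ℝ) : ℂ) := by
    intro a i j
    have hs : Real.sqrt d * Real.sqrt d = d := Real.mul_self_sqrt (Nat.cast_nonneg d)
    simp only [φ, Complex.star_def, Complex.conj_ofReal]
    rw [← Complex.ofReal_mul, div_mul_div_comm, hs]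
    push_cast
    field_simp
  have hoff : ∀ i j, i ≠ j → D i j = 0 := by
    intro i j hij
    have hm := moment_aux (fun k => β k / β i₁) i₁ i j (div_self hβ1.ne') hij
    have hm' := congrArg (fun x : ℝ => (x : ℂ)) hm
    have hS : ∑ a ∈ Finset.univ.filter (fun a : Fin d → ℤˣ => a i₁ = 1),
        ((p a : ℝ) : ℂ) * 𝒲 a i j = - (d : ℂ)⁻¹ * ((β i / β i₁ * (β j / β i₁) : ℝ) : ℂ) := by
      rw [← hm, Complex.ofReal_sum, Finset.mul_sum]
      refine Finset.sum_congr rfl fun a _ => ?_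
      simp only [𝒲, Matrix.sub_apply, Matrix.smul_apply, Matrix.one_apply_ne hij,
        Matrix.vecMulVec_apply, Pi.star_apply, hφ, p]
      rw [Complex.ofReal_mul (Finset.prod _ _)]
      simp only [smul_zero]
      ring
    simp only [D, W, ψ, Matrix.sub_apply, Matrix.smul_apply, Matrix.sum_apply, smul_eq_mul, hS,
      Matrix.one_apply_ne hij, Matrix.vecMulVec_apply, Pi.star_apply, Complex.star_def,
      Complex.conj_ofReal]
    push_cast
    field_simp
    ring
  have hdiag : ∀ i, D i i = (((β i₁) ^ 2 - (β i) ^ 2 : ℝ) : ℂ) := by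
    intro i
    have h0 : ∀ a, 𝒲 a i i = 0 := by
      intro a
      simp only [𝒲, Matrix.sub_apply, Matrix.smul_apply, Matrix.one_apply_eq,
        Matrix.vecMulVec_apply, Pi.star_apply, hφ]
      rcases Int.units_eq_one_or (a i) with h | h <;> simp [h]
    simp only [D, W, ψ, Matrix.sub_apply, Matrix.smul_apply, Matrix.sum_apply, smul_eq_mul, h0,
      Matrix.one_apply_eq, Matrix.vecMulVec_apply, Pi.star_apply, Complex.star_def,
      Complex.conj_ofReal, mul_zero, Finset.sum_const_zero]
    push_cast
    ring
  have hnn : ∀ i, 0 ≤ (β i₁) ^ 2 - (β i) ^ 2 := fun i =>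
    sub_nonneg.2 (pow_le_pow_left₀ (hβpos i) (hβmax i) 2)
  refine ⟨fun i j hij => hoff i j hij, hdiag, hnn, ?_⟩
  have hD : D = Matrix.diagonal (fun i => (((β i₁) ^ 2 - (β i) ^ 2 : ℝ) : ℂ)) := by
    ext i j
    by_cases hij : i = j
    · subst hij
      rw [hdiag, Matrix.diagonal_apply_eq]
    · rw [hoff i j hij, Matrix.diagonal_apply_ne _ hij]
  rw [hD]
  refine Matrix.PosSemidef.diagonal fun i => ?_
  exact Complex.zero_le_real.2 (hnn i)
end

section
/- Let ρ be a density matrix on ℂ^d. If there exists a unit vector ψ ∈ ℂ^d with nonnegative real coordinates β_i such that ⟨ψ|ρ|ψ⟩ > max_i β_i², then there exists a sign vector a such that ⟨φ_a|ρ|φ_a⟩ > 1/d; that is, if ρ is detected by a fidelity-based coherence witness with nonnegative real coefficients, then ρ is detected by one of the 2^{d−1} relevant fidelity coherence witnesses 𝒲_a = I/d − |φ_a⟩⟨φ_a|. -/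
open Matrix ComplexOrder

lemma qf_eq {d : ℕ} (ρ : Matrix (Fin d) (Fin d) ℂ) (v : Fin d → ℝ) :
    (star (fun i => ((v i : ℝ) : ℂ)) ⬝ᵥ ρ.mulVec (fun i => ((v i : ℝ) : ℂ))).re
      = ∑ i, ∑ j, v i * v j * (ρ i j).re := by
  simp only [dotProduct, mulVec, Complex.re_sum, Finset.mul_sum]
  refine Finset.sum_congr rfl fun i _ => Finset.sum_congr rfl fun j _ => ?_
  simp
  ring

lemma qf_convex {d : ℕ} (ρ : Matrix (Fin d) (Fin d) ℂ) (hρ : ρ.PosSemidef) :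
    ConvexOn ℝ Set.univ (fun v : Fin d → ℝ => ∑ i, ∑ j, v i * v j * (ρ i j).re) := by
  refine ⟨convex_univ, ?_⟩
  intro v _ w _ a b ha hb hab
  have h1 : 0 ≤ ∑ i, ∑ j, (v i - w i) * (v j - w j) * (ρ i j).re := by
    have := hρ.dotProduct_mulVec_nonneg (fun i => (((v i - w i) : ℝ) : ℂ))
    rw [← qf_eq ρ (fun i => v i - w i)]
    exact (Complex.le_def.1 this).1
  have h2 : ∑ i, ∑ j, (a • v + b • w) i * (a • v + b • w) j * (ρ i j).re
      = a * (∑ i, ∑ j, v i * v j * (ρ i j).re) + b * (∑ i, ∑ j, w i * w j * (ρ i j).re)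
        - a * b * ∑ i, ∑ j, (v i - w i) * (v j - w j) * (ρ i j).re := by
    simp only [Finset.mul_sum, ← Finset.sum_add_distrib, ← Finset.sum_sub_distrib]
    refine Finset.sum_congr rfl fun i _ => Finset.sum_congr rfl fun j _ => ?_
    obtain rfl : a = 1 - b := by linarith
    simp only [Pi.add_apply, Pi.smul_apply, smul_eq_mul]
    ring
  have h3 := mul_nonneg (mul_nonneg ha hb) h1
  simp only [smul_eq_mul] at *
  linarith

/-- If a density matrix ρ on ℂ^d is detected by a fidelity-based coherence
witness built from a unit vector ψ with nonnegative real coordinates β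
(i.e. ⟨ψ|ρ|ψ⟩ > max_i β_i²), then ρ is detected by one of the 2^{d−1} relevant fidelity
coherence witnesses: ⟨φ_a|ρ|φ_a⟩ > 1/d for some sign vector a (a_1 = 1). -/
theorem stmt_4 (d : ℕ) (hd : 0 < d) (ρ : Matrix (Fin d) (Fin d) ℂ)
    (hρ : ρ.PosSemidef) (hρtr : ρ.trace = 1)
    (β : Fin d → ℝ) (hβpos : ∀ i, 0 ≤ β i) (hβnorm : ∑ i, (β i) ^ 2 = 1)
    (hdet : (star (fun i => ((β i : ℝ) : ℂ)) ⬝ᵥ ρ.mulVec (fun i => ((β i : ℝ) : ℂ))).re >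
      ⨆ i, (β i) ^ 2) :
    ∃ a : Fin d → ℤˣ, a ⟨0, hd⟩ = 1 ∧
      (star (fun i => ((((a i : ℤ) : ℝ) / Real.sqrt d : ℝ) : ℂ)) ⬝ᵥ
        ρ.mulVec (fun i => ((((a i : ℤ) : ℝ) / Real.sqrt d : ℝ) : ℂ))).re > 1 / d := by
  have hne : Nonempty (Fin d) := ⟨⟨0, hd⟩⟩
  rw [qf_eq] at hdet
  obtain ⟨k, hk⟩ := Finite.exists_max β
  have hle : (β k) ^ 2 ≤ ⨆ i, (β i) ^ 2 := le_ciSup (f := fun i => (β i) ^ 2) (Set.finite_range _).bddAbove k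
  have hm : 0 < β k := by
    rcases (hβpos k).lt_or_eq with h | h
    · exact h
    · have : ∀ i, β i = 0 := fun i => le_antisymm (h ▸ hk i) (hβpos i)
      simp [this] at hβnorm
  have hx : 1 < ∑ i, ∑ j, (β i / β k) * (β j / β k) * (ρ i j).re := by
    have : ∑ i, ∑ j, (β i / β k) * (β j / β k) * (ρ i j).re
        = (∑ i, ∑ j, β i * β j * (ρ i j).re) / (β k) ^ 2 := by
      simp only [Finset.sum_div]
      refine Finset.sum_congr rfl fun i _ => Finset.sum_congr rfl fun j _ => ?_
      field_simp
    rw [this, lt_div_iff₀ (by positivity)]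
    linarith
  have hmem : (fun i => β i / β k) ∈
      convexHull ℝ (Set.univ.pi (fun _ : Fin d => ({-1, 1} : Set ℝ))) := by
    rw [convexHull_pi]
    intro i _
    rw [convexHull_pair, segment_eq_Icc (by norm_num)]
    have h0 : 0 ≤ β i / β k := div_nonneg (hβpos i) hm.le
    exact ⟨by linarith, (div_le_one hm).2 (hk i)⟩
  obtain ⟨y, hy, hxy⟩ := ((qf_convex ρ hρ).subset (Set.subset_univ _)
    (convex_convexHull ℝ _)).exists_ge_of_mem_convexHull (subset_convexHull ℝ _) hmem
  have hy' : ∀ i, ∃ u : ℤˣ, ((u : ℤ) : ℝ) = y i := by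
    intro i
    rcases hy i (Set.mem_univ i) with h | h
    · exact ⟨-1, by simp [h]⟩
    · exact ⟨1, by simp_all⟩
  choose u hu using hy'
  refine ⟨fun i => u ⟨0, hd⟩ * u i, by simp, ?_⟩
  rw [qf_eq]
  have hd' : (0 : ℝ) < d := by exact_mod_cast hd
  have hs : Real.sqrt d * Real.sqrt d = d := Real.mul_self_sqrt hd'.le
  have hu0 : y ⟨0, hd⟩ * y ⟨0, hd⟩ = 1 := by
    rcases hy ⟨0, hd⟩ (Set.mem_univ _) with h | h
    · rw [h]; norm_num
    · rw [Set.mem_singleton_iff.1 h]; norm_num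
  have : ∀ i j, (((u ⟨0, hd⟩ * u i : ℤˣ) : ℤ) : ℝ) / Real.sqrt d *
      ((((u ⟨0, hd⟩ * u j : ℤˣ) : ℤ) : ℝ) / Real.sqrt d) * (ρ i j).re
      = y i * y j * (ρ i j).re / d := by
    intro i j
    push_cast
    rw [hu, hu, hu, div_mul_div_comm, hs]
    calc _ = (y ⟨0, hd⟩ * y ⟨0, hd⟩) * (y i * y j * (ρ i j).re / d) := by ring
      _ = _ := by rw [hu0, one_mul]
  simp only [this, ← Finset.sum_div]
  exact div_lt_div_of_pos_right (lt_of_lt_of_le hx hxy) hd'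
end

section
/- (Theorem 1) Let ρ be a density matrix on ℂ^d. Then ρ is faithful — i.e., there exists a unit vector ψ ∈ ℂ^d with real coordinates such that ⟨ψ|ρ|ψ⟩ > max_i ψ_i² — if and only if there exists a sign vector a such that ⟨φ_a|ρ|φ_a⟩ > 1/d; equivalently, if and only if there is a diagonal unitary U with diagonal entries ±1 and first entry 1 such that ⟨Φ⁺|U ρ U|Φ⁺⟩ > 1/d. -/
open Matrix ComplexOrder

noncomputable def QQ {d : ℕ} (ρ : Matrix (Fin d) (Fin d) ℂ) (x : Fin d → ℝ) : ℝ :=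
  ∑ i, ∑ j, x i * (ρ i j).re * x j

lemma QQ_eq {d : ℕ} (ρ : Matrix (Fin d) (Fin d) ℂ) (x : Fin d → ℝ) :
    (star (fun i => ((x i : ℝ) : ℂ)) ⬝ᵥ ρ.mulVec (fun i => ((x i : ℝ) : ℂ))).re = QQ ρ x := by
  simp only [dotProduct, mulVec, QQ, Pi.star_apply, Finset.mul_sum, Complex.re_sum]
  refine Finset.sum_congr rfl fun i _ => Finset.sum_congr rfl fun j _ => ?_
  simp
  ring

lemma QQ_smul {d : ℕ} (ρ : Matrix (Fin d) (Fin d) ℂ) (c : ℝ) (x : Fin d → ℝ) :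
    QQ ρ (fun i => c * x i) = c ^ 2 * QQ ρ x := by
  simp only [QQ, Finset.mul_sum]
  refine Finset.sum_congr rfl fun i _ => Finset.sum_congr rfl fun j _ => ?_
  ring

lemma QQ_nonneg {d : ℕ} {ρ : Matrix (Fin d) (Fin d) ℂ} (hρ : ρ.PosSemidef) (x : Fin d → ℝ) :
    0 ≤ QQ ρ x := by
  rw [← QQ_eq]
  exact (Complex.le_def.1 (hρ.dotProduct_mulVec_nonneg _)).1

lemma QQ_convex {d : ℕ} {ρ : Matrix (Fin d) (Fin d) ℂ} (hρ : ρ.PosSemidef) :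
    ConvexOn ℝ Set.univ (QQ ρ) := by
  refine ⟨convex_univ, fun x _ y _ s t hs ht hst => ?_⟩
  have key : s * QQ ρ x + t * QQ ρ y = QQ ρ (s • x + t • y) + s * t * QQ ρ (x - y) := by
    obtain rfl : s = 1 - t := by linarith
    simp only [QQ, Finset.mul_sum, ← Finset.sum_add_distrib]
    refine Finset.sum_congr rfl fun i _ => Finset.sum_congr rfl fun j _ => ?_
    simp
    ring
  have := mul_nonneg (mul_nonneg hs ht) (QQ_nonneg hρ (x - y))
  simp only [smul_eq_mul]
  linarith

lemma exists_vertex {d : ℕ} {ρ : Matrix (Fin d) (Fin d) ℂ} (hρ : ρ.PosSemidef)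
    (y : Fin d → ℝ) (hy : ∀ i, |y i| ≤ 1) :
    ∃ a : Fin d → ℤˣ, QQ ρ y ≤ QQ ρ (fun i => ((a i : ℤ) : ℝ)) := by
  have hm : y ∈ convexHull ℝ (Set.pi Set.univ (fun _ : Fin d => ({-1, 1} : Set ℝ))) := by
    rw [convexHull_pi]
    intro i _
    rw [convexHull_pair, segment_eq_Icc (by norm_num)]
    exact abs_le.1 (hy i)
  obtain ⟨z, hz, hle⟩ := ((QQ_convex hρ).subset (Set.subset_univ _)
    (convex_convexHull ℝ _)).exists_ge_of_mem_convexHull (subset_convexHull ℝ _) hm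
  refine ⟨fun i => if z i = 1 then 1 else -1, ?_⟩
  refine hle.trans_eq (congrArg _ (funext fun i => ?_))
  have := hz i trivial
  simp only [Set.mem_insert_iff, Set.mem_singleton_iff] at this
  rcases this with h | h
  · have h1 : ¬ z i = 1 := by rw [h]; norm_num
    beta_reduce
    rw [if_neg h1, h]; simp
  · beta_reduce
    rw [if_pos h, h]; simp

lemma faithful_iff {d : ℕ} (hd : 0 < d) {ρ : Matrix (Fin d) (Fin d) ℂ} (hρ : ρ.PosSemidef) :
    (∃ ψ : Fin d → ℝ, (∑ i, (ψ i) ^ 2 = 1) ∧ QQ ρ ψ > ⨆ i, (ψ i) ^ 2) ↔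
    ∃ a : Fin d → ℤˣ, a ⟨0, hd⟩ = 1 ∧ QQ ρ (fun i => ((a i : ℤ) : ℝ)) > 1 := by
  have hd' : (0 : ℝ) < d := by exact_mod_cast hd
  haveI : Nonempty (Fin d) := ⟨⟨0, hd⟩⟩
  have hsq : ∀ u : ℤˣ, ((u : ℤ) : ℝ) ^ 2 = 1 := fun u => by
    rcases Int.units_eq_one_or u with h | h <;> simp [h]
  constructor
  · rintro ⟨ψ, h1, h2⟩
    obtain ⟨k, hk⟩ := Finite.exists_max (fun i => |ψ i|)
    have hM : |ψ k| ^ 2 < QQ ρ ψ := by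
      rw [sq_abs]
      exact (le_ciSup (f := fun i => ψ i ^ 2) (Set.finite_range _).bddAbove k).trans_lt h2
    set M := |ψ k| with hMdef
    have hMpos : 0 < M := by
      rcases (abs_nonneg (ψ k)).lt_or_eq with h | h
      · exact h
      · exfalso
        have : ∀ i, ψ i = 0 := fun i => abs_nonpos_iff.1 ((hk i).trans h.symm.le)
        simp [this] at h1
    obtain ⟨a, ha⟩ := exists_vertex hρ (fun i => M⁻¹ * ψ i) (fun i => by
      rw [abs_mul, abs_of_pos (inv_pos.2 hMpos), inv_mul_le_iff₀ hMpos, mul_one]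
      exact hk i)
    rw [QQ_smul] at ha
    have h3 : 1 < M⁻¹ ^ 2 * QQ ρ ψ := by
      rw [inv_pow, lt_inv_mul_iff₀ (by positivity), mul_one]
      exact hM
    refine ⟨fun i => a ⟨0, hd⟩ * a i, by simp, ?_⟩
    have := QQ_smul ρ ((a ⟨0, hd⟩ : ℤ) : ℝ) (fun i => ((a i : ℤ) : ℝ))
    rw [hsq, one_mul] at this
    push_cast
    rw [this]
    linarith
  · rintro ⟨a, -, ha⟩
    have hs : ((Real.sqrt d)⁻¹) ^ 2 = (d : ℝ)⁻¹ := by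
      rw [inv_pow, Real.sq_sqrt hd'.le]
    refine ⟨fun i => (Real.sqrt d)⁻¹ * ((a i : ℤ) : ℝ), ?_, ?_⟩
    · simp only [mul_pow, hsq, hs]
      simp [hd'.ne']
    · rw [QQ_smul]
      simp only [mul_pow, hsq, hs]
      rw [ciSup_const]
      exact mul_lt_mul_of_pos_left ha (inv_pos.2 hd')

/-- Theorem 1: A density matrix ρ on ℂ^d is faithful (detected by some
fidelity-based coherence witness with a real-coordinate unit vector ψ:
⟨ψ|ρ|ψ⟩ > max_i ψ_i²) iff ⟨φ_a|ρ|φ_a⟩ > 1/d for some sign vector a, iff there is a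
diagonal unitary U with ±1 diagonal entries and first entry 1 such that
⟨Φ⁺|UρU|Φ⁺⟩ > 1/d. -/
theorem stmt_5 (d : ℕ) (hd : 0 < d) (ρ : Matrix (Fin d) (Fin d) ℂ)
    (hρ : ρ.PosSemidef) (hρtr : ρ.trace = 1) :
    let Φ : Fin d → ℂ := fun _ => ((1 / Real.sqrt d : ℝ) : ℂ)
    let φ : (Fin d → ℤˣ) → Fin d → ℂ := fun a i => ((((a i : ℤ) : ℝ) / Real.sqrt d : ℝ) : ℂ)
    let faithful : Prop := ∃ ψ : Fin d → ℝ, (∑ i, (ψ i) ^ 2 = 1) ∧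
      (star (fun i => ((ψ i : ℝ) : ℂ)) ⬝ᵥ ρ.mulVec (fun i => ((ψ i : ℝ) : ℂ))).re >
        ⨆ i, (ψ i) ^ 2
    (faithful ↔ ∃ a : Fin d → ℤˣ, a ⟨0, hd⟩ = 1 ∧
      (star (φ a) ⬝ᵥ ρ.mulVec (φ a)).re > 1 / d) ∧
    (faithful ↔ ∃ u : Fin d → ℤˣ, u ⟨0, hd⟩ = 1 ∧
      (star Φ ⬝ᵥ ((Matrix.diagonal (fun i => (((u i : ℤ) : ℝ) : ℂ)) * ρ *
        Matrix.diagonal (fun i => (((u i : ℤ) : ℝ) : ℂ))).mulVec Φ)).re > 1 / d) := by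
  intro Φ φ faithful
  have hd' : (0 : ℝ) < d := by exact_mod_cast hd
  have hs : ((Real.sqrt d)⁻¹) ^ 2 = (d : ℝ)⁻¹ := by
    rw [inv_pow, Real.sq_sqrt hd'.le]
  have hf : faithful ↔ ∃ a : Fin d → ℤˣ, a ⟨0, hd⟩ = 1 ∧
      QQ ρ (fun i => ((a i : ℤ) : ℝ)) > 1 := by
    rw [← faithful_iff hd hρ]
    simp only [faithful, QQ_eq]
  have e1 : ∀ a : Fin d → ℤˣ, (star (φ a) ⬝ᵥ ρ.mulVec (φ a)).re =
      (d : ℝ)⁻¹ * QQ ρ (fun i => ((a i : ℤ) : ℝ)) := fun a => by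
    simp only [φ]
    rw [QQ_eq ρ (fun i => ((a i : ℤ) : ℝ) / Real.sqrt d), ← hs, ← QQ_smul]
    congr 1
    ext i
    rw [div_eq_inv_mul]
  have e2 : ∀ a : Fin d → ℤˣ, (star Φ ⬝ᵥ ((Matrix.diagonal (fun i => (((a i : ℤ) : ℝ) : ℂ)) * ρ *
        Matrix.diagonal (fun i => (((a i : ℤ) : ℝ) : ℂ))).mulVec Φ)).re =
      (star (φ a) ⬝ᵥ ρ.mulVec (φ a)).re := fun a => by
    congr 1
    simp only [dotProduct, mulVec, Finset.mul_sum, Matrix.mul_diagonal, Matrix.diagonal_mul]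
    refine Finset.sum_congr rfl fun i _ => Finset.sum_congr rfl fun j _ => ?_
    simp [Φ, φ]
    ring
  have e3 : ∀ q : ℝ, (d : ℝ)⁻¹ * q > 1 / d ↔ q > 1 := fun q => by
    rw [gt_iff_lt, gt_iff_lt, lt_inv_mul_iff₀ hd', mul_one_div_cancel hd'.ne']
  constructor
  · rw [hf]
    simp only [e1, e3]
  · rw [hf]
    simp only [e2, e1, e3]
end

section
/- Let ρ be a density matrix on ℂ^d, let σ be an incoherent state, and let λ ∈ ℝ be such that 2^λ σ − ρ is positive semidefinite. Then for every sign vector a one has d · ⟨φ_a|ρ|φ_a⟩ ≤ 2^λ; in particular, with 𝒲 = I/d − |Φ⁺⟩⟨Φ⁺| one has 1 − d·Tr(𝒲ρ) = d⟨Φ⁺|ρ|Φ⁺⟩ ≤ 2^λ. Consequently the measured value 1 − d·Tr(𝒲ρ) is a lower bound for 2^{C_max(ρ)}, where C_max(ρ) = inf over incoherent σ of min{λ : ρ ≤ 2^λ σ}. -/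
open Matrix ComplexOrder

lemma key_bound (d : ℕ) (hd : 0 < d) (ρ σ : Matrix (Fin d) (Fin d) ℂ)
    (hσtr : σ.trace = 1) (hσdiag : σ.IsDiag)
    (lam : ℝ) (hlam : (((((2 : ℝ) ^ lam : ℝ)) : ℂ) • σ - ρ).PosSemidef)
    (s : Fin d → ℝ) (hs : ∀ i, s i * s i = 1) (v : Fin d → ℂ)
    (hv : v = fun i => ((s i / Real.sqrt d : ℝ) : ℂ)) :
    (d : ℝ) * (star v ⬝ᵥ ρ.mulVec v).re ≤ (2 : ℝ) ^ lam := by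
  have hd' : (0 : ℝ) < d := by exact_mod_cast hd
  have h1 : star v ⬝ᵥ σ.mulVec v = ((1 / d : ℝ) : ℂ) := by
    have h2 : ∀ i, star v i * σ.mulVec v i = ((1 / d : ℝ) : ℂ) * σ i i := by
      intro i
      have h3 : σ.mulVec v i = σ i i * v i := by
        rw [Matrix.mulVec, dotProduct]
        apply Finset.sum_eq_single i
        · intro j _ hj
          rw [hσdiag (Ne.symm hj), zero_mul]
        · simp
      have h4 : star v i * v i = ((1 / d : ℝ) : ℂ) := by
        rw [hv, Pi.star_apply, RCLike.star_def, Complex.conj_ofReal, ← Complex.ofReal_mul,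
          div_mul_div_comm, hs, Real.mul_self_sqrt hd'.le]
      rw [h3, ← h4]; ring
    rw [dotProduct, Finset.sum_congr rfl (fun i _ => h2 i), ← Finset.mul_sum]
    have : ∑ i, σ i i = 1 := hσtr
    rw [this, mul_one]
  have h := hlam.dotProduct_mulVec_nonneg v
  rw [Matrix.sub_mulVec, dotProduct_sub, Matrix.smul_mulVec, dotProduct_smul, h1,
    smul_eq_mul, ← Complex.ofReal_mul] at h
  have h5 := (Complex.le_def.1 h).1
  rw [Complex.sub_re, Complex.ofReal_re, Complex.zero_re] at h5
  have h6 : (star v ⬝ᵥ ρ.mulVec v).re ≤ (2:ℝ)^lam * (1/d) := by linarith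
  calc _ ≤ (d:ℝ) * ((2:ℝ)^lam * (1/d)) := by gcongr
    _ = _ := by field_simp

/-- If ρ is a density matrix, σ an incoherent state and λ ∈ ℝ with
2^λ σ − ρ ⪰ 0, then d⟨φ_a|ρ|φ_a⟩ ≤ 2^λ for every sign vector a; with
𝒲 = I/d − |Φ⁺⟩⟨Φ⁺| one has 1 − d·Tr(𝒲ρ) = d⟨Φ⁺|ρ|Φ⁺⟩ ≤ 2^λ, and consequently
1 − d·Tr(𝒲ρ) ≤ 2^{C_max(ρ)} where C_max(ρ) = inf_{σ incoherent} min{λ : ρ ≤ 2^λ σ}. -/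
theorem stmt_11 (d : ℕ) (hd : 0 < d) (ρ σ : Matrix (Fin d) (Fin d) ℂ)
    (hρ : ρ.PosSemidef) (hρtr : ρ.trace = 1)
    (hσ : σ.PosSemidef) (hσtr : σ.trace = 1) (hσdiag : σ.IsDiag)
    (lam : ℝ) (hlam : (((((2 : ℝ) ^ lam : ℝ)) : ℂ) • σ - ρ).PosSemidef) :
    let φ : (Fin d → ℤˣ) → Fin d → ℂ := fun a i => ((((a i : ℤ) : ℝ) / Real.sqrt d : ℝ) : ℂ)
    let Φ : Fin d → ℂ := fun _ => ((1 / Real.sqrt d : ℝ) : ℂ)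
    let 𝒲 : Matrix (Fin d) (Fin d) ℂ :=
      ((d : ℂ))⁻¹ • (1 : Matrix (Fin d) (Fin d) ℂ) - Matrix.vecMulVec Φ (star Φ)
    (∀ a : Fin d → ℤˣ, a ⟨0, hd⟩ = 1 →
      (d : ℝ) * (star (φ a) ⬝ᵥ ρ.mulVec (φ a)).re ≤ (2 : ℝ) ^ lam) ∧
    (1 - (d : ℝ) * ((𝒲 * ρ).trace).re = (d : ℝ) * (star Φ ⬝ᵥ ρ.mulVec Φ).re) ∧
    ((d : ℝ) * (star Φ ⬝ᵥ ρ.mulVec Φ).re ≤ (2 : ℝ) ^ lam) ∧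
    (1 - (d : ℝ) * ((𝒲 * ρ).trace).re ≤
      (2 : ℝ) ^ sInf {μ : ℝ | ∃ σ' : Matrix (Fin d) (Fin d) ℂ,
        σ'.PosSemidef ∧ σ'.trace = 1 ∧ σ'.IsDiag ∧
        (((((2 : ℝ) ^ μ : ℝ)) : ℂ) • σ' - ρ).PosSemidef}) := by
  intro φ Φ 𝒲
  have hd' : (d : ℂ) ≠ 0 := by exact_mod_cast hd.ne'
  have hΦ : ∀ (σ' : Matrix (Fin d) (Fin d) ℂ) (μ : ℝ), σ'.trace = 1 → σ'.IsDiag →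
      (((((2 : ℝ) ^ μ : ℝ)) : ℂ) • σ' - ρ).PosSemidef →
      (d : ℝ) * (star Φ ⬝ᵥ ρ.mulVec Φ).re ≤ (2 : ℝ) ^ μ := fun σ' μ h1 h2 h3 =>
    key_bound d hd ρ σ' h1 h2 μ h3 (fun _ => 1) (by simp) Φ rfl
  have heq : 1 - (d : ℝ) * ((𝒲 * ρ).trace).re = (d : ℝ) * (star Φ ⬝ᵥ ρ.mulVec Φ).re := by
    have h1 : (𝒲 * ρ).trace = (d : ℂ)⁻¹ - star Φ ⬝ᵥ ρ.mulVec Φ := by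
      simp only [𝒲]
      rw [Matrix.sub_mul, Matrix.trace_sub, Matrix.smul_mul, Matrix.one_mul, Matrix.trace_smul,
        hρtr, Matrix.vecMulVec_mul, Matrix.trace_vecMulVec, smul_eq_mul, mul_one,
        dotProduct_comm, Matrix.dotProduct_mulVec]
    have h2 : ((d : ℂ)⁻¹).re = (d : ℝ)⁻¹ := by
      rw [← Complex.ofReal_natCast, ← Complex.ofReal_inv, Complex.ofReal_re]
    have h3 : (d : ℝ) ≠ 0 := by exact_mod_cast hd.ne'
    rw [h1, Complex.sub_re, h2, mul_sub, mul_inv_cancel₀ h3]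
    ring
  refine ⟨fun a _ => ?_, heq, hΦ σ lam hσtr hσdiag hlam, ?_⟩
  · refine key_bound d hd ρ σ hσtr hσdiag lam hlam (fun i => ((a i : ℤ) : ℝ)) (fun i => ?_) _ rfl
    rcases Int.units_eq_one_or (a i) with h | h <;> simp [h]
  · rw [heq]
    by_cases hx : 0 < (d : ℝ) * (star Φ ⬝ᵥ ρ.mulVec Φ).re
    · rw [← Real.logb_le_iff_le_rpow (by norm_num) hx]
      apply le_csInf
      · exact ⟨lam, σ, hσ, hσtr, hσdiag, hlam⟩
      · rintro μ ⟨σ', _, h2, h3, h4⟩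
        rw [Real.logb_le_iff_le_rpow (by norm_num) hx]
        exact hΦ σ' μ h2 h3 h4
    · exact (not_lt.1 hx).trans (by positivity)
end

section
/- If ρ is a coherent density matrix on ℂ^d (i.e., ρ_{ij} ≠ 0 for some i ≠ j), then there exists a Hermitian matrix W (a coherence witness) such that Tr(Wδ) ≥ 0 for every incoherent state δ while Tr(Wρ) < 0. -/
open Matrix ComplexOrder

/-- Every coherent density matrix ρ on ℂ^d admits a coherence witness:
a Hermitian W with Tr(Wδ) ≥ 0 for all incoherent states δ and Tr(Wρ) < 0. -/
theorem stmt_15 (d : ℕ) (ρ : Matrix (Fin d) (Fin d) ℂ)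
    (hρ : ρ.PosSemidef) (hρtr : ρ.trace = 1)
    (hcoh : ∃ i j : Fin d, i ≠ j ∧ ρ i j ≠ 0) :
    ∃ W : Matrix (Fin d) (Fin d) ℂ, W.IsHermitian ∧
      (∀ δ : Matrix (Fin d) (Fin d) ℂ, δ.PosSemidef → δ.trace = 1 → δ.IsDiag →
        0 ≤ ((W * δ).trace).re) ∧
      ((W * ρ).trace).re < 0 := by
  obtain ⟨i, j, hij, hne⟩ := hcoh
  have hH : ∀ k l, ρ l k = star (ρ k l) := fun k l => (hρ.isHermitian.apply l k).symm
  refine ⟨Matrix.of fun k l => if k = l then 0 else - ρ k l, ?_, ?_, ?_⟩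
  · ext k l
    by_cases h : k = l
    · subst h
      simp
    · have h' : ¬ l = k := fun e => h e.symm
      simp only [Matrix.conjTranspose_apply, Matrix.of_apply, if_neg h, if_neg h', star_neg]
      rw [← hH l k]
  · intro δ _ _ hd
    apply le_of_eq
    have : ((Matrix.of fun k l => if k = l then 0 else - ρ k l) * δ).trace = 0 := by
      simp only [Matrix.trace, Matrix.diag_apply, Matrix.mul_apply, Matrix.of_apply]
      refine Finset.sum_eq_zero fun k _ => Finset.sum_eq_zero fun l _ => ?_
      by_cases h : k = l
      · simp [h]
      · rw [hd (fun e => h e.symm), mul_zero]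
    rw [this]
    rfl
  · simp only [Matrix.trace, Matrix.diag_apply, Matrix.mul_apply, Matrix.of_apply, Complex.re_sum]
    have key : ∀ k l, ((if k = l then 0 else - ρ k l) * ρ l k).re
        = if k = l then 0 else - Complex.normSq (ρ k l) := by
      intro k l
      by_cases h : k = l
      · simp [h]
      · rw [if_neg h, if_neg h, hH k l]
        simp [Complex.normSq_apply]
    have le : ∀ k l, ((if k = l then 0 else - ρ k l) * ρ l k).re ≤ 0 := by
      intro k l
      rw [key]
      split_ifs
      · exact le_rfl
      · exact neg_nonpos.mpr (Complex.normSq_nonneg _)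
    refine Finset.sum_neg' (fun k _ => Finset.sum_nonpos fun l _ => le k l)
      ⟨i, Finset.mem_univ _, Finset.sum_neg' (fun l _ => le i l) ⟨j, Finset.mem_univ _, ?_⟩⟩
    rw [key, if_neg hij]
    exact neg_neg_of_pos (Complex.normSq_pos.mpr hne)
end

section
/- Let ρ be a density matrix on ℂ^d and let Δ(ρ) = Σ_i ⟨i|ρ|i⟩ |i⟩⟨i| be its diagonal part. Then the Hermitian operator W = ρ − Δ(ρ) satisfies Tr(Wδ) = 0 for every incoherent state δ, and Tr(Wρ) = Σ_{i≠j} |ρ_{ij}|²; in particular Tr(Wρ) > 0 whenever ρ is coherent, so every coherent state admits a witness with zero mean value on all incoherent states and nonzero mean value on itself. -/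
open Matrix ComplexOrder

/-- For a density matrix ρ on ℂ^d with diagonal part Δ(ρ), the Hermitian
operator W = ρ − Δ(ρ) satisfies Tr(Wδ) = 0 for every incoherent state δ and
Tr(Wρ) = Σ_{i≠j} |ρ_{ij}|²; in particular Tr(Wρ) > 0 whenever ρ is coherent. -/
theorem stmt_16 (d : ℕ) (ρ : Matrix (Fin d) (Fin d) ℂ)
    (hρ : ρ.PosSemidef) (hρtr : ρ.trace = 1) :
    let W : Matrix (Fin d) (Fin d) ℂ := ρ - Matrix.diagonal (fun i => ρ i i)
    W.IsHermitian ∧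
    (∀ δ : Matrix (Fin d) (Fin d) ℂ, δ.PosSemidef → δ.trace = 1 → δ.IsDiag →
      (W * δ).trace = 0) ∧
    (W * ρ).trace =
      ((∑ i, ∑ j ∈ Finset.univ.filter (fun j => j ≠ i), ‖ρ i j‖ ^ 2 : ℝ) : ℂ) ∧
    ((∃ i j : Fin d, i ≠ j ∧ ρ i j ≠ 0) → 0 < ((W * ρ).trace).re) := by
  intro W
  have hW : ∀ i j, W i j = if j ≠ i then ρ i j else 0 := by
    intro i j
    by_cases h : j = i
    · subst h
      simp [W]
    · have h' : i ≠ j := fun e => h e.symm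
      simp [W, h, Matrix.diagonal_apply_ne _ h']
  have hs : ∀ i j, star (ρ j i) = ρ i j := fun i j => hρ.isHermitian.apply i j
  have htr : (W * ρ).trace =
      ((∑ i, ∑ j ∈ Finset.univ.filter (fun j => j ≠ i), ‖ρ i j‖ ^ 2 : ℝ) : ℂ) := by
    simp only [Matrix.trace, Matrix.diag_apply, Matrix.mul_apply, hW]
    push_cast
    refine Finset.sum_congr rfl fun i _ => ?_
    rw [Finset.sum_filter]
    refine Finset.sum_congr rfl fun j _ => ?_
    split_ifs
    · rw [← hs j i]
      exact Complex.mul_conj' _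
    · simp
  refine ⟨?_, ?_, htr, ?_⟩
  · ext i j
    rw [Matrix.conjTranspose_apply, hW, hW]
    by_cases h : i = j
    · simp [h]
    · have h' : j ≠ i := fun e => h e.symm
      simp only [ne_eq, h, h', not_false_eq_true, if_true]
      exact hs i j
  · intro δ _ _ hδ
    simp only [Matrix.trace, Matrix.diag_apply, Matrix.mul_apply, hW]
    refine Finset.sum_eq_zero fun i _ => Finset.sum_eq_zero fun j _ => ?_
    split_ifs with h
    · rw [hδ h, mul_zero]
    · simp
  · rintro ⟨i, j, hij, hne⟩
    rw [htr, Complex.ofReal_re]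
    refine Finset.sum_pos' (fun _ _ => Finset.sum_nonneg fun _ _ => by positivity)
      ⟨i, Finset.mem_univ _, ?_⟩
    refine Finset.sum_pos' (fun _ _ => by positivity) ⟨j, by simp [hij.symm], ?_⟩
    have := norm_pos_iff.mpr hne
    positivity
end
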